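/- Let n ≥ 1. Then P_{n−1}^⊥(T_1) ∩ P_{n−1}^⊥(K_{1,0}) is one-dimensional, spanned by the polynomial q_n^{(1,0)}(x,y) := y^{−1}( P_{n+1}^{(1,1)}(1−2(x+y)) − P_{n+1}^{(1,1)}(1−2x) ), which is a bivariate polynomial of total degree n. (Here K_{1,0} = conv°((1,0),(0,0),(1,−1)).) -/

import Mathlib

open MeasureTheory Finset

noncomputable section

/-- 2×2 determinant of two vectors in `ℝ²`. -/
def det2 (u v : ℝ × ℝ) : ℝ := u.1 * v.2 - u.2 * v.1

/-- The open triangle with vertices `A`, `B`, `C` (interior of the convex hull). -/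
def tri (A B C : ℝ × ℝ) : Set (ℝ × ℝ) := interior (convexHull ℝ {A, B, C})

/-- Barycentric coordinate of `p` with respect to the vertex `A` of triangle `ABC`. -/
def bary (A B C p : ℝ × ℝ) : ℝ := det2 (p - B) (C - B) / det2 (A - B) (C - B)

/-- The cubic bubble: product of the three barycentric coordinates of triangle `ABC`. -/
def bubble (A B C p : ℝ × ℝ) : ℝ := bary A B C p * bary B C A p * bary C A B p

/-- Evaluation of a bivariate polynomial at a point of `ℝ²`. -/
def evalP (u : MvPolynomial (Fin 2) ℝ) (p : ℝ × ℝ) : ℝ :=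
  MvPolynomial.eval ![p.1, p.2] u

/-- The inner product `(u,v)_K := ∫_K u v ω_K` on the open triangle `K = conv°(A,B,C)`,
with weight the product of the barycentric coordinates. -/
def innerT (A B C : ℝ × ℝ) (u v : MvPolynomial (Fin 2) ℝ) : ℝ :=
  ∫ p in tri A B C, evalP u p * evalP v p * bubble A B C p

/-- `u ∈ P_{n-1}^⊥(K)` for `K = conv°(A,B,C)`: `u` has total degree at most `n` and is
orthogonal to every polynomial of total degree at most `n-1` w.r.t. `(·,·)_K`. -/
def inPerp (n : ℕ) (A B C : ℝ × ℝ) (u : MvPolynomial (Fin 2) ℝ) : Prop :=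
  u.totalDegree ≤ n ∧
    ∀ w : MvPolynomial (Fin 2) ℝ, w.totalDegree ≤ n - 1 → innerT A B C u w = 0

/-- Shifted factorial (Pochhammer symbol) `(a)_k = a (a+1) ⋯ (a+k-1)`. -/
def poch (a : ℝ) (k : ℕ) : ℝ := ∏ j ∈ Finset.range k, (a + j)

/-- The Jacobi polynomial `P_n^{(a,b)}` as a univariate real polynomial,
`P_n^{(a,b)}(x) = ((a+1)_n/n!) Σ_{k=0}^n ((-n)_k (n+a+b+1)_k)/((a+1)_k k!) ((1-x)/2)^k`. -/
def jacobiPoly (n : ℕ) (a b : ℝ) : Polynomial ℝ :=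
  Polynomial.C (poch (a + 1) n / (n.factorial : ℝ)) *
    ∑ k ∈ Finset.range (n + 1),
      Polynomial.C (poch (-(n : ℝ)) k * poch ((n : ℝ) + a + b + 1) k /
          (poch (a + 1) k * (k.factorial : ℝ))) *
        (Polynomial.C (2⁻¹ : ℝ) * (1 - Polynomial.X)) ^ k

/-- The value `P_n^{(a,b)}(x)` of the Jacobi polynomial. -/
def jacobiR (n : ℕ) (a b x : ℝ) : ℝ := (jacobiPoly n a b).eval x

/-- Substitute a bivariate polynomial into a univariate polynomial. -/
def substX (f : Polynomial ℝ) (g : MvPolynomial (Fin 2) ℝ) : MvPolynomial (Fin 2) ℝ :=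
  Polynomial.aeval g f

open MvPolynomial

/-- The second-order operator whose eigenspaces are the spaces of orthogonal polynomials on the
unit triangle with weight `x y (1 - x - y)`. -/
def triangleOp (u : MvPolynomial (Fin 2) ℝ) : MvPolynomial (Fin 2) ℝ :=
  X 0 * (1 - X 0) * pderiv 0 (pderiv 0 u) - 2 * X 0 * X 1 * pderiv 0 (pderiv 1 u) +
    X 1 * (1 - X 1) * pderiv 1 (pderiv 1 u) + (2 - 6 * X 0) * pderiv 0 u +
    (2 - 6 * X 1) * pderiv 1 u

lemma pderiv_pderiv_comm (u : MvPolynomial (Fin 2) ℝ) :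
    pderiv 1 (pderiv 0 u) = pderiv 0 (pderiv 1 u) := by
  ext m
  simp only [coeff_pderiv, add_right_comm m]
  simp
  ring

lemma triangleOp_add (u v : MvPolynomial (Fin 2) ℝ) :
    triangleOp (u + v) = triangleOp u + triangleOp v := by
  simp only [triangleOp, map_add]
  ring

lemma totalDegree_monomial_fin_two_le (s : Fin 2 →₀ ℕ) (c : ℝ) :
    (monomial s c).totalDegree ≤ s 0 + s 1 := by
  refine (totalDegree_monomial_le s c).trans ?_
  rw [Finsupp.sum_fintype _ _ (by simp)]
  simp

lemma totalDegree_pderiv_monomial_le (i : Fin 2) (s : Fin 2 →₀ ℕ) (c : ℝ) :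
    (pderiv i (monomial s c)).totalDegree ≤ s 0 + s 1 - 1 := by
  rw [pderiv_monomial]
  by_cases h : s i = 0
  · simp [h]
  · refine (totalDegree_monomial_fin_two_le _ _).trans ?_
    fin_cases i <;> simp at h ⊢ <;> omega

lemma triangleOp_monomial (s : Fin 2 →₀ ℕ) (c : ℝ) :
    triangleOp (monomial s c) =
      C ((s 0 : ℝ) + 1) * pderiv 0 (monomial s c) + C ((s 1 : ℝ) + 1) * pderiv 1 (monomial s c) -
        C (((s 0 : ℝ) + s 1) * (s 0 + s 1 + 5)) * monomial s c := by
  have h0 : X 0 * pderiv 0 (monomial s c) = C (s 0 : ℝ) * monomial s c := by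
    rw [X_mul_pderiv_monomial, nsmul_eq_mul]; simp
  have h1 : X 1 * pderiv 1 (monomial s c) = C (s 1 : ℝ) * monomial s c := by
    rw [X_mul_pderiv_monomial, nsmul_eq_mul]; simp
  have h00 := congrArg (pderiv 0) h0
  have h01 := congrArg (pderiv 0) h1
  have h11 := congrArg (pderiv 1) h1
  simp only [Derivation.leibniz, smul_eq_mul, pderiv_X_self, derivation_C, pderiv_X_of_ne,
    ne_eq, one_ne_zero, not_false_eq_true, mul_zero, add_zero, mul_one] at h00 h01 h11
  simp only [triangleOp, map_add, map_mul, map_one, map_ofNat]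
  linear_combination (1 - X 0) * h00 + (1 - X 1) * h11 - 2 * X 0 * h01
    - (5 + C (s 0 : ℝ) + 2 * C (s 1 : ℝ)) * h0 - (5 + C (s 1 : ℝ)) * h1

/-- `triangleOp` acts on the leading form of degree `n` as multiplication by `-n (n + 5)`. -/
lemma totalDegree_triangleOp_add_le {n : ℕ} {u : MvPolynomial (Fin 2) ℝ}
    (hu : u.totalDegree ≤ n) :
    (triangleOp u + C ((n : ℝ) * (n + 5)) * u).totalDegree ≤ n - 1 := by
  let N := restrictTotalDegree (Fin 2) ℝ (n - 1)
  have hmono : ∀ s : Fin 2 →₀ ℕ, ∀ c : ℝ, s 0 + s 1 ≤ n →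
      triangleOp (monomial s c) + C ((n : ℝ) * (n + 5)) * monomial s c ∈ N := by
    intro s c hs
    have hd : ∀ i : Fin 2, pderiv i (monomial s c) ∈ N := fun i ↦ by
      rw [mem_restrictTotalDegree]
      exact (totalDegree_pderiv_monomial_le i s c).trans (by omega)
    have hm : C ((n : ℝ) * (n + 5) - ((s 0 : ℝ) + s 1) * (s 0 + s 1 + 5)) * monomial s c ∈ N := by
      rw [C_mul']
      rcases hs.eq_or_lt with h | h
      · have : (n : ℝ) = s 0 + s 1 := by rw [← h]; push_cast; rfl
        simp [this]
      · refine N.smul_mem _ ?_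
        rw [mem_restrictTotalDegree]
        exact (totalDegree_monomial_fin_two_le _ _).trans (by omega)
    have := N.add_mem (N.add_mem (N.smul_mem ((s 0 : ℝ) + 1) (hd 0))
      (N.smul_mem ((s 1 : ℝ) + 1) (hd 1))) hm
    convert this using 1
    rw [triangleOp_monomial]
    simp only [← C_mul', map_sub, map_add, map_mul]
    ring
  have hadd : ∀ s : Finset (Fin 2 →₀ ℕ), (∀ m ∈ s, m 0 + m 1 ≤ n) →
      triangleOp (∑ m ∈ s, monomial m (coeff m u)) +
        C ((n : ℝ) * (n + 5)) * ∑ m ∈ s, monomial m (coeff m u) ∈ N := by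
    intro s
    induction s using Finset.induction_on with
    | empty => intro _; simp [triangleOp]
    | insert a s ha ih =>
      intro h
      rw [Finset.sum_insert ha, triangleOp_add]
      convert N.add_mem (hmono a (coeff a u) (h a (Finset.mem_insert_self a s)))
        (ih fun m hm ↦ h m (Finset.mem_insert_of_mem hm)) using 1
      ring
  have := hadd u.support fun m hm ↦ by
    have := (le_totalDegree hm).trans hu
    rwa [Finsupp.sum_fintype _ _ (by simp), Fin.sum_univ_two] at this
  rwa [← u.as_sum, mem_restrictTotalDegree] at this

lemma totalDegree_triangleOp_le {n : ℕ} {u : MvPolynomial (Fin 2) ℝ}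
    (hu : u.totalDegree ≤ n) : (triangleOp u).totalDegree ≤ n := by
  have h : triangleOp u = (triangleOp u + C ((n : ℝ) * (n + 5)) * u) +
      (-((n : ℝ) * (n + 5))) • u := by
    rw [← C_mul', C_neg]; ring
  rw [h]
  refine (totalDegree_add _ _).trans (max_le ?_ ((totalDegree_smul_le _ _).trans hu))
  exact (totalDegree_triangleOp_add_le hu).trans (Nat.sub_le n 1)

/-- The moments of the weight `x y (1 - x - y)` on the unit triangle. -/
def HasTriangleMoments (L : MvPolynomial (Fin 2) ℝ →ₗ[ℝ] ℝ) : Prop :=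
  ∀ (s : Fin 2 →₀ ℕ) (c : ℝ), L (monomial s c) =
    c * (((s 0 + 1).factorial * (s 1 + 1).factorial : ℝ) / (s 0 + s 1 + 5).factorial)

section Moments

variable {L : MvPolynomial (Fin 2) ℝ →ₗ[ℝ] ℝ}

/-- The divergence theorem for the vector field `f x_i e_i - f x_i (x_i e_i + x_j e_j)`. -/
lemma HasTriangleMoments.divergence (hL : HasTriangleMoments L) {i j : Fin 2} (hij : j ≠ i)
    (f : MvPolynomial (Fin 2) ℝ) :
    L ((2 - 6 * X i) * f + X i * (1 - X i) * pderiv i f - X i * X j * pderiv j f) = 0 := by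
  have hL' (s : Fin 2 →₀ ℕ) (c : ℝ) : L (monomial s c) =
      c * (((s i + 1).factorial * (s j + 1).factorial : ℝ) / (s i + s j + 5).factorial) := by
    rw [hL]
    fin_cases i <;> fin_cases j <;> first | exact absurd rfl hij | simp [mul_comm, add_comm]
  induction f using MvPolynomial.induction_on' with
  | add p q hp hq =>
    have h := (map_add L _ _).trans ((congrArg₂ (· + ·) hp hq).trans (add_zero 0))
    refine Eq.trans (congrArg L ?_) h
    simp only [map_add]
    ring
  | monomial s c =>
    have h0 : X i * pderiv i (monomial s c) = C (s i : ℝ) * monomial s c := by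
      rw [X_mul_pderiv_monomial, nsmul_eq_mul]; simp
    have h1 : X j * pderiv j (monomial s c) = C (s j : ℝ) * monomial s c := by
      rw [X_mul_pderiv_monomial, nsmul_eq_mul]; simp
    have hX : X i * monomial s c = monomial (s + Finsupp.single i 1) c := by
      rw [X, monomial_mul, one_mul, add_comm]
    have : (2 - 6 * X i) * monomial s c + X i * (1 - X i) * pderiv i (monomial s c) -
        X i * X j * pderiv j (monomial s c) = ((s i : ℝ) + 2) • monomial s c -
          ((s i : ℝ) + s j + 6) • monomial (s + Finsupp.single i 1) c := by
      simp only [← hX, ← C_mul', map_add, map_ofNat]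
      linear_combination (1 - X i) * h0 - X i * h1
    rw [this, map_sub, map_smul, map_smul, hL', hL']
    simp only [Finsupp.add_apply, Finsupp.single_eq_same, smul_eq_mul,
      Finsupp.single_eq_of_ne hij, add_zero]
    rw [show s i + 1 + s j + 5 = (s i + s j + 5) + 1 by ring, Nat.factorial_succ (s i + s j + 5),
      Nat.factorial_succ (s i + 1)]
    push_cast
    have : ((s i + s j + 5).factorial : ℝ) ≠ 0 := by positivity
    have : ((s i : ℝ) + s j + 5 + 1) ≠ 0 := by positivity
    field_simp
    ring

lemma HasTriangleMoments.map_triangleOp_mul_add (hL : HasTriangleMoments L)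
    (u v : MvPolynomial (Fin 2) ℝ) :
    L (triangleOp u * v) +
      L (X 0 * (1 - X 0) * pderiv 0 u * pderiv 0 v
        - X 0 * X 1 * (pderiv 0 u * pderiv 1 v + pderiv 1 u * pderiv 0 v)
        + X 1 * (1 - X 1) * pderiv 1 u * pderiv 1 v) = 0 := by
  have h := (map_add L _ _).trans ((congrArg₂ (· + ·)
    (hL.divergence one_ne_zero (pderiv 0 u * v))
    (hL.divergence zero_ne_one (pderiv 1 u * v))).trans (add_zero 0))
  refine (map_add L _ _).symm.trans (Eq.trans (congrArg L ?_) h)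
  simp only [triangleOp, pderiv_mul, pderiv_pderiv_comm]
  ring

lemma HasTriangleMoments.map_triangleOp_mul (hL : HasTriangleMoments L)
    (u v : MvPolynomial (Fin 2) ℝ) :
    L (triangleOp u * v) = L (u * triangleOp v) := by
  have h1 := hL.map_triangleOp_mul_add u v
  have h2 := hL.map_triangleOp_mul_add v u
  rw [mul_comm u]
  refine add_right_cancel (h1.trans (h2.symm.trans ?_))
  congr 2
  ring

lemma HasTriangleMoments.orthogonal_of_triangleOp_eq (hL : HasTriangleMoments L)
    {n : ℕ} {q : MvPolynomial (Fin 2) ℝ} (hq : triangleOp q = C (-((n : ℝ) * (n + 5))) * q) :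
    ∀ k < n, ∀ v : MvPolynomial (Fin 2) ℝ, v.totalDegree ≤ k → L (q * v) = 0 := by
  have step : ∀ k < n, ∀ v : MvPolynomial (Fin 2) ℝ,
      L (q * (triangleOp v + C ((k : ℝ) * (k + 5)) * v)) = 0 → L (q * v) = 0 := by
    intro k hk v hv
    have hs := hL.map_triangleOp_mul q v
    have e1 : triangleOp q * v = (-((n : ℝ) * (n + 5))) • (q * v) := by
      rw [hq, ← C_mul']; ring
    have e2 : q * (triangleOp v + C ((k : ℝ) * (k + 5)) * v) =
        q * triangleOp v + ((k : ℝ) * (k + 5)) • (q * v) := by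
      rw [← C_mul']; ring
    rw [e1, map_smul, smul_eq_mul] at hs
    rw [e2, map_add, map_smul, smul_eq_mul, ← hs] at hv
    have hk' : (k : ℝ) < n := by exact_mod_cast hk
    have hne : ((k : ℝ) - n) * (k + n + 5) ≠ 0 :=
      mul_ne_zero (by linarith) (by positivity)
    refine (mul_eq_zero.mp ?_).resolve_left hne
    linear_combination hv
  intro k
  induction k with
  | zero =>
    intro hk v hv
    refine step 0 hk v ?_
    rw [totalDegree_eq_zero_iff_eq_C.mp (Nat.le_zero.mp hv)]
    simp [triangleOp]
  | succ k ih =>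
    intro hk v hv
    exact step (k + 1) hk v (ih (by omega) _ (totalDegree_triangleOp_add_le hv))

lemma HasTriangleMoments.triangleOp_eq_of_orthogonal (hL : HasTriangleMoments L)
    (hpos : ∀ u, L (u * u) = 0 → u = 0)
    {n : ℕ} {u : MvPolynomial (Fin 2) ℝ} (hu : u.totalDegree ≤ n)
    (hperp : ∀ v : MvPolynomial (Fin 2) ℝ, v.totalDegree ≤ n - 1 → L (u * v) = 0) :
    triangleOp u = C (-((n : ℝ) * (n + 5))) * u := by
  have hd := totalDegree_triangleOp_add_le hu
  have h0 := hpos (triangleOp u + C ((n : ℝ) * (n + 5)) * u) (by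
    set r := triangleOp u + C ((n : ℝ) * (n + 5)) * u with hr
    have : r * r = triangleOp u * r + ((n : ℝ) * (n + 5)) • (u * r) := by
      conv_lhs => rw [hr]
      rw [← C_mul', ← hr]; ring
    rw [this, map_add, map_smul, hL.map_triangleOp_mul, hperp _ hd,
      hperp _ (totalDegree_triangleOp_le hd)]
    simp)
  rw [C_neg]
  linear_combination h0

end Moments

/-- Composition with the affine involution `(x, y) ↦ (x + y, -y)`, which exchanges the two
triangles. -/
def reflect : MvPolynomial (Fin 2) ℝ →ₐ[ℝ] MvPolynomial (Fin 2) ℝ :=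
  aeval ![X 0 + X 1, -X 1]

@[simp]
lemma reflect_X_zero : reflect (X 0) = X 0 + X 1 := by simp [reflect]

@[simp]
lemma reflect_X_one : reflect (X 1) = -X 1 := by simp [reflect]

@[simp]
lemma reflect_C (a : ℝ) : reflect (C a) = C a := by simp [reflect, algebraMap_eq]

@[simp]
lemma reflect_reflect (u : MvPolynomial (Fin 2) ℝ) : reflect (reflect u) = u := by
  have : reflect.comp reflect = AlgHom.id ℝ (MvPolynomial (Fin 2) ℝ) := by
    ext i : 1
    fin_cases i <;> simp
  exact DFunLike.congr_fun this u

lemma pderiv_zero_reflect (u : MvPolynomial (Fin 2) ℝ) :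
    pderiv 0 (reflect u) = reflect (pderiv 0 u) := by
  induction u using MvPolynomial.induction_on with
  | C a => simp
  | add p q hp hq => simp [hp, hq]
  | mul_X p i hp =>
    simp only [map_mul, pderiv_mul, hp, map_add]
    fin_cases i <;> simp

lemma pderiv_one_reflect (u : MvPolynomial (Fin 2) ℝ) :
    pderiv 1 (reflect u) = reflect (pderiv 0 u - pderiv 1 u) := by
  induction u using MvPolynomial.induction_on with
  | C a => simp
  | add p q hp hq => simp only [map_add, hp, hq, map_sub]; ring
  | mul_X p i hp =>
    simp only [map_mul, pderiv_mul, hp, map_add, map_sub]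
    fin_cases i <;> simp <;> ring

lemma totalDegree_reflect_le (u : MvPolynomial (Fin 2) ℝ) :
    (reflect u).totalDegree ≤ u.totalDegree := by
  rw [reflect, aeval_def, eval₂_eq']
  refine totalDegree_finsetSum_le fun d hd ↦ ?_
  refine (totalDegree_mul _ _).trans ?_
  rw [algebraMap_eq, totalDegree_C, zero_add, Fin.prod_univ_two]
  refine ((totalDegree_mul _ _).trans
    (add_le_add (totalDegree_pow _ _) (totalDegree_pow _ _))).trans ?_
  have h0 : (X 0 + X 1 : MvPolynomial (Fin 2) ℝ).totalDegree ≤ 1 :=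
    (totalDegree_add _ _).trans (by simp)
  have h1 : (-X 1 : MvPolynomial (Fin 2) ℝ).totalDegree ≤ 1 := by simp
  have := le_totalDegree hd
  rw [Finsupp.sum_fintype _ _ (by simp), Fin.sum_univ_two] at this
  simp only [Matrix.cons_val_zero, Matrix.cons_val_one]
  nlinarith

/-- An eigenfunction of `triangleOp` whose reflection is one too solves
`∂ₓ∂_y (y u) = ∂_y² (y u)`. -/
lemma pderiv_pderiv_X_mul_eq {u : MvPolynomial (Fin 2) ℝ} {c : ℝ}
    (hu : triangleOp u = C c * u) (hr : triangleOp (reflect u) = C c * reflect u) :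
    pderiv 0 (pderiv 1 (X 1 * u)) = pderiv 1 (pderiv 1 (X 1 * u)) := by
  have h := congrArg reflect hr
  simp only [triangleOp, pderiv_zero_reflect, pderiv_one_reflect, map_add, map_sub, map_mul,
    reflect_reflect, reflect_X_zero, reflect_X_one, reflect_C, map_one, map_ofNat,
    pderiv_pderiv_comm] at h
  simp only [triangleOp] at hu
  have h2 : (2 : MvPolynomial (Fin 2) ℝ) ≠ 0 := two_ne_zero
  refine mul_left_cancel₀ h2 ?_
  simp only [pderiv_mul, pderiv_X_self, pderiv_X_of_ne one_ne_zero, map_add, pderiv_one]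
  linear_combination h - hu

lemma coeff_of_pderiv_pderiv_X_mul_eq {u : MvPolynomial (Fin 2) ℝ}
    (hu : pderiv 0 (pderiv 1 (X 1 * u)) = pderiv 1 (pderiv 1 (X 1 * u))) (m : Fin 2 →₀ ℕ) :
    ((m 0 : ℝ) + 1) * coeff (m + Finsupp.single 0 1) u =
      ((m 1 : ℝ) + 2) * coeff (m + Finsupp.single 1 1) u := by
  have h := congrArg (coeff m) hu
  simp only [coeff_pderiv, mul_comm (X 1) u, coeff_mul_X] at h
  simp at h
  have : (m 1 : ℝ) + 1 ≠ 0 := by positivity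
  refine mul_left_cancel₀ this ?_
  linear_combination h

lemma totalDegree_le_of_pderiv_pderiv_X_mul_eq {n : ℕ} {u : MvPolynomial (Fin 2) ℝ}
    (hdeg : u.totalDegree ≤ n)
    (hu : pderiv 0 (pderiv 1 (X 1 * u)) = pderiv 1 (pderiv 1 (X 1 * u)))
    (h0 : coeff (Finsupp.single 0 n) u = 0) : u.totalDegree ≤ n - 1 := by
  have key : ∀ j, ∀ m : Fin 2 →₀ ℕ, m 1 = j → m 0 + m 1 = n → coeff m u = 0 := by
    intro j
    induction j with
    | zero =>
      intro m hm hs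
      rw [hm, add_zero] at hs
      convert h0
      ext i
      fin_cases i <;> simp [hm, hs]
    | succ j ih =>
      intro m hm hs
      have hle : Finsupp.single 1 1 ≤ m := by
        rw [Finsupp.single_le_iff]; omega
      have h := coeff_of_pderiv_pderiv_X_mul_eq hu (m - Finsupp.single 1 1)
      rw [tsub_add_cancel_of_le hle, ih _ (by simp [hm]) (by simp [hm]; omega), mul_zero] at h
      exact (mul_eq_zero.mp h.symm).resolve_left (by positivity)
  rw [totalDegree_eq]
  refine Finset.sup_le fun m hm ↦ ?_
  have h1 := (le_totalDegree hm).trans hdeg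
  rw [Finsupp.card_toMultiset]
  rw [Finsupp.sum_fintype _ _ (by simp), Fin.sum_univ_two] at h1 ⊢
  have : m 0 + m 1 ≠ n := fun h ↦ (mem_support_iff.mp hm) (key _ m rfl h)
  simp only [id]
  omega

/-- The divided difference `(f (x + y) - f x) / y`. -/
def dividedDifference (f : Polynomial ℝ) : MvPolynomial (Fin 2) ℝ :=
  f.sum fun k a ↦ C a * ∑ i ∈ Finset.range k, (X 0 + X 1) ^ i * X 0 ^ (k - 1 - i)

lemma X_mul_dividedDifference (f : Polynomial ℝ) :
    X 1 * dividedDifference f =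
      Polynomial.aeval (X 0 + X 1 : MvPolynomial (Fin 2) ℝ) f -
        Polynomial.aeval (X 0 : MvPolynomial (Fin 2) ℝ) f := by
  simp only [Polynomial.aeval_def, Polynomial.eval₂_eq_sum, dividedDifference, Polynomial.sum,
    Finset.mul_sum, ← Finset.sum_sub_distrib, ← mul_sub, algebraMap_eq]
  refine Finset.sum_congr rfl fun k _ ↦ ?_
  rw [← (Commute.all _ _).geom_sum₂_mul, ← Finset.mul_sum, ← Finset.mul_sum]
  ring

lemma totalDegree_dividedDifference_le {n : ℕ} {f : Polynomial ℝ} (hf : f.natDegree ≤ n + 1) :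
    (dividedDifference f).totalDegree ≤ n := by
  refine totalDegree_finsetSum_le fun k hk ↦ ?_
  have hk' : k ≤ n + 1 := (Polynomial.le_natDegree_of_mem_supp k hk).trans hf
  refine (totalDegree_mul _ _).trans ?_
  rw [totalDegree_C, zero_add]
  refine totalDegree_finsetSum_le fun i hi ↦ ?_
  have hi' := Finset.mem_range.mp hi
  refine ((totalDegree_mul _ _).trans
    (add_le_add (totalDegree_pow _ _) (totalDegree_pow _ _))).trans ?_
  have h0 : (X 0 + X 1 : MvPolynomial (Fin 2) ℝ).totalDegree ≤ 1 :=
    (totalDegree_add _ _).trans (by simp)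
  rw [totalDegree_X, mul_one]
  have := Nat.mul_le_mul_left i h0
  omega

lemma coeff_aeval_X_zero (u : MvPolynomial (Fin 2) ℝ) (n : ℕ) :
    (aeval ![Polynomial.X, 0] u : Polynomial ℝ).coeff n = coeff (Finsupp.single 0 n) u := by
  induction u using MvPolynomial.induction_on' with
  | add p q hp hq => simp [hp, hq]
  | monomial s c =>
    rw [aeval_monomial, Finsupp.prod_fintype _ _ (by simp), coeff_monomial]
    simp only [Fin.prod_univ_two, Matrix.cons_val_zero, Matrix.cons_val_one,
      Polynomial.algebraMap_eq]
    by_cases h1 : s 1 = 0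
    · rw [h1, pow_zero, mul_one, Polynomial.coeff_C_mul_X_pow]
      refine if_congr ⟨fun h ↦ ?_, fun h ↦ by simp [h]⟩ rfl rfl
      ext i
      fin_cases i <;> simp [h, h1]
    · rw [zero_pow h1, if_neg]
      · simp
      · rintro rfl
        simp at h1

lemma pderiv_aeval (i : Fin 2) (f : Polynomial ℝ) (g : MvPolynomial (Fin 2) ℝ) :
    pderiv i (Polynomial.aeval g f) = Polynomial.aeval g (Polynomial.derivative f) * pderiv i g := by
  rw [Derivation.comp_aeval_eq, smul_eq_mul]

lemma coeff_dividedDifference (f : Polynomial ℝ) (n : ℕ) :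
    coeff (Finsupp.single 0 n) (dividedDifference f) = f.coeff (n + 1) * (n + 1) := by
  have h := congrArg (fun u ↦ aeval ![Polynomial.X, (0 : Polynomial ℝ)] (pderiv 1 u))
    (X_mul_dividedDifference f)
  simp [← Polynomial.aeval_algHom_apply] at h
  rw [← coeff_aeval_X_zero, h, Polynomial.coeff_derivative]

lemma reflect_dividedDifference (f : Polynomial ℝ) :
    reflect (dividedDifference f) = dividedDifference f := by
  have h := X_mul_dividedDifference f
  have hr := congrArg reflect h
  simp only [map_mul, map_sub, ← Polynomial.aeval_algHom_apply, map_add, reflect_X_zero,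
    reflect_X_one] at hr
  rw [add_neg_cancel_right] at hr
  refine mul_left_cancel₀ (X_ne_zero (R := ℝ) (1 : Fin 2)) ?_
  linear_combination -hr - h

lemma triangleOp_dividedDifference {n : ℕ} {f : Polynomial ℝ}
    (hf : Polynomial.X * (1 - Polynomial.X) * Polynomial.derivative (Polynomial.derivative f) +
      (2 - 4 * Polynomial.X) * Polynomial.derivative f +
      Polynomial.C (((n : ℝ) + 1) * (n + 4)) * f = 0) :
    triangleOp (dividedDifference f) = C (-((n : ℝ) * (n + 5))) * dividedDifference f := by
  have h := X_mul_dividedDifference f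
  have h0 := congrArg (pderiv 0) h
  have h1 := congrArg (pderiv 1) h
  have h00 := congrArg (pderiv 0) h0
  have h01 := congrArg (pderiv 0) h1
  have h11 := congrArg (pderiv 1) h1
  have hs := congrArg (Polynomial.aeval (X 0 + X 1 : MvPolynomial (Fin 2) ℝ)) hf
  have hx := congrArg (Polynomial.aeval (X 0 : MvPolynomial (Fin 2) ℝ)) hf
  simp only [map_add, map_sub, map_mul, pderiv_mul, pderiv_aeval, pderiv_X_self,
    pderiv_X_of_ne one_ne_zero, pderiv_X_of_ne zero_ne_one, Polynomial.aeval_X,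
    map_one, map_ofNat, map_zero, zero_mul, mul_zero,
    zero_add, add_zero, one_mul, mul_one, sub_zero, map_natCast] at h0 h1 h00 h01 h11 hs hx
  refine mul_left_cancel₀ (X_ne_zero (R := ℝ) (1 : Fin 2)) ?_
  simp only [triangleOp, map_neg, map_mul, map_add, map_natCast, map_ofNat]
  linear_combination X 0 * (1 - X 0) * h00 - 2 * X 0 * X 1 * h01 + X 1 * (1 - X 1) * h11 +
    (2 - 6 * X 0) * h0 + 2 * X 0 * h0 - 2 * (1 - X 1) * h1 + (2 - 6 * X 1) * h1 + hs - hx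
      + (((n : MvPolynomial (Fin 2) ℝ) + 1) * (n + 4)) * h

/-- The coefficient of `x ^ k` in the shifted Jacobi polynomial `P_N^{(1,1)}(1 - 2 x)`. -/
def shiftedJacobiCoeff (N k : ℕ) : ℝ :=
  poch (1 + 1) N / (N.factorial : ℝ) *
    (poch (-(N : ℝ)) k * poch ((N : ℝ) + 1 + 1 + 1) k / (poch (1 + 1) k * (k.factorial : ℝ)))

lemma poch_pos {a : ℝ} (ha : 0 < a) (k : ℕ) : 0 < poch a k :=
  Finset.prod_pos fun _ _ ↦ by positivity

lemma poch_succ (a : ℝ) (k : ℕ) : poch a (k + 1) = poch a k * (a + k) :=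
  Finset.prod_range_succ _ _

lemma poch_neg_ne_zero (N : ℕ) : poch (-(N : ℝ)) N ≠ 0 := by
  refine Finset.prod_ne_zero_iff.mpr fun j hj ↦ ?_
  have : (j : ℝ) < N := by exact_mod_cast Finset.mem_range.mp hj
  linarith

lemma poch_neg_eq_zero {N k : ℕ} (h : N < k) : poch (-(N : ℝ)) k = 0 :=
  Finset.prod_eq_zero (Finset.mem_range.mpr h) (by simp)

lemma shiftedJacobiCoeff_succ (N k : ℕ) :
    ((k : ℝ) + 1) * (k + 2) * shiftedJacobiCoeff N (k + 1) =
      ((k : ℝ) - N) * (k + N + 3) * shiftedJacobiCoeff N k := by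
  have h1 := (poch_pos (a := 1 + 1) (by norm_num) k).ne'
  have h2 : (k.factorial : ℝ) ≠ 0 := by positivity
  have h3 : (1 + 1 + k : ℝ) ≠ 0 := by positivity
  have h4 : (N.factorial : ℝ) ≠ 0 := by positivity
  simp only [shiftedJacobiCoeff, poch_succ, Nat.factorial_succ]
  push_cast
  field_simp
  ring

/-- The shifted Jacobi polynomial `P_N^{(1,1)}(1 - 2 x)`. -/
def shiftedJacobi (N : ℕ) : Polynomial ℝ :=
  (jacobiPoly N 1 1).comp (1 - 2 * Polynomial.X)

lemma coeff_shiftedJacobi (N k : ℕ) : (shiftedJacobi N).coeff k = shiftedJacobiCoeff N k := by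
  have hX : (Polynomial.C (2⁻¹ : ℝ) * (1 - (1 - 2 * Polynomial.X))) = Polynomial.X := by
    rw [sub_sub_cancel, ← mul_assoc, ← Polynomial.C_ofNat, ← Polynomial.C_mul]
    norm_num
  have : shiftedJacobi N = ∑ k ∈ Finset.range (N + 1),
      Polynomial.C (shiftedJacobiCoeff N k) * Polynomial.X ^ k := by
    simp only [shiftedJacobi, jacobiPoly, Polynomial.mul_comp, Polynomial.C_comp,
      Polynomial.sum_comp, Polynomial.pow_comp, Polynomial.sub_comp, Polynomial.one_comp,
      Polynomial.X_comp, hX, Finset.mul_sum, shiftedJacobiCoeff, ← mul_assoc, ← Polynomial.C_mul]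
  rw [this, Polynomial.finsetSum_coeff]
  simp only [Polynomial.coeff_C_mul_X_pow]
  rw [Finset.sum_ite_eq]
  split_ifs with h
  · rfl
  · rw [shiftedJacobiCoeff, poch_neg_eq_zero (by simpa using h)]
    simp

lemma natDegree_shiftedJacobi_le (N : ℕ) : (shiftedJacobi N).natDegree ≤ N := by
  refine Polynomial.natDegree_le_iff_coeff_eq_zero.mpr fun k hk ↦ ?_
  rw [coeff_shiftedJacobi, shiftedJacobiCoeff, poch_neg_eq_zero hk]
  simp

lemma shiftedJacobi_coeff_ne_zero (N : ℕ) : (shiftedJacobi N).coeff N ≠ 0 := by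
  have h1 := (poch_pos (a := 1 + 1) (by norm_num) N).ne'
  have h2 : (N.factorial : ℝ) ≠ 0 := by positivity
  have h3 := (poch_pos (a := (N : ℝ) + 1 + 1 + 1) (by positivity) N).ne'
  have h4 := poch_neg_ne_zero N
  rw [coeff_shiftedJacobi, shiftedJacobiCoeff]
  positivity

lemma shiftedJacobi_ode (n : ℕ) :
    Polynomial.X * (1 - Polynomial.X) *
        Polynomial.derivative (Polynomial.derivative (shiftedJacobi (n + 1))) +
      (2 - 4 * Polynomial.X) * Polynomial.derivative (shiftedJacobi (n + 1)) +
      Polynomial.C (((n : ℝ) + 1) * (n + 4)) * shiftedJacobi (n + 1) = 0 := by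
  set f := shiftedJacobi (n + 1) with hf
  obtain ⟨c, hc⟩ : ∃ c : ℝ, c = ((n : ℝ) + 1) * (n + 4) := ⟨_, rfl⟩
  rw [← hc]
  have key : Polynomial.X * (1 - Polynomial.X) * Polynomial.derivative (Polynomial.derivative f) +
      (2 - 4 * Polynomial.X) * Polynomial.derivative f +
      Polynomial.C c * f =
    Polynomial.X * Polynomial.derivative (Polynomial.derivative f) -
      Polynomial.X * (Polynomial.X * Polynomial.derivative (Polynomial.derivative f)) +
      (Polynomial.C 2 * Polynomial.derivative f -
        Polynomial.C 4 * (Polynomial.X * Polynomial.derivative f)) +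
      Polynomial.C c * f := by
    simp only [Polynomial.C_ofNat]; ring
  rw [key]
  ext k
  have hk := fun k ↦ shiftedJacobiCoeff_succ (n + 1) k
  push_cast at hk
  rcases k with _ | _ | k
  · simp [Polynomial.coeff_derivative, hf, coeff_shiftedJacobi]
    have := hk 0
    push_cast at this
    linear_combination this + shiftedJacobiCoeff (n + 1) 0 * hc
  · simp [Polynomial.coeff_derivative, Polynomial.coeff_X_mul, hf, coeff_shiftedJacobi]
    have := hk 1
    push_cast at this
    linear_combination this + shiftedJacobiCoeff (n + 1) 1 * hc
  · simp [Polynomial.coeff_derivative, Polynomial.coeff_X_mul, hf, coeff_shiftedJacobi]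
    have := hk (k + 2)
    push_cast at this
    linear_combination this + shiftedJacobiCoeff (n + 1) (k + 2) * hc

lemma continuous_evalP (u : MvPolynomial (Fin 2) ℝ) : Continuous (evalP u) := by
  refine (MvPolynomial.continuous_eval u).comp (continuous_pi fun i ↦ ?_)
  fin_cases i
  exacts [continuous_fst, continuous_snd]

lemma evalP_mul (u v : MvPolynomial (Fin 2) ℝ) (p : ℝ × ℝ) :
    evalP (u * v) p = evalP u p * evalP v p := map_mul _ _ _

lemma bubble_unit_triangle (p : ℝ × ℝ) :
    bubble (0, 0) (1, 0) (0, 1) p = (1 - p.1 - p.2) * p.1 * p.2 := by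
  simp only [bubble, bary, det2, Prod.fst_sub, Prod.snd_sub]
  ring

/-- The closed unit triangle. -/
def closedTriangle : Set (ℝ × ℝ) := {p | 0 ≤ p.1 ∧ 0 ≤ p.2 ∧ p.1 + p.2 ≤ 1}

lemma convexHull_eq_closedTriangle :
    convexHull ℝ {((0 : ℝ), (0 : ℝ)), (1, 0), (0, 1)} = closedTriangle := by
  apply Set.Subset.antisymm
  · refine convexHull_min ?_ ?_
    · rintro p (rfl | rfl | rfl) <;> norm_num [closedTriangle]
    · rintro p ⟨h1, h2, h3⟩ q ⟨h4, h5, h6⟩ a b ha hb hab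
      refine ⟨?_, ?_, ?_⟩
      · simp only [Prod.fst_add, Prod.smul_fst, smul_eq_mul]; positivity
      · simp only [Prod.snd_add, Prod.smul_snd, smul_eq_mul]; positivity
      · simp only [Prod.fst_add, Prod.smul_fst, Prod.snd_add, Prod.smul_snd, smul_eq_mul]
        nlinarith
  · rintro ⟨x, y⟩ ⟨h1, h2, h3⟩
    simp only at h1 h2 h3
    have hc := convex_convexHull ℝ {((0 : ℝ), (0 : ℝ)), (1, 0), (0, 1)}
    have := hc.sum_mem (t := Finset.univ) (w := ![1 - x - y, x, y])
      (z := ![((0 : ℝ), (0 : ℝ)), (1, 0), (0, 1)])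
      (by intro i _; fin_cases i <;> simp <;> linarith)
      (by simp only [Fin.sum_univ_three, Matrix.cons_val]; ring)
      (by intro i _; apply subset_convexHull; fin_cases i <;> simp)
    simpa [Fin.sum_univ_three] using this

lemma isCompact_closedTriangle : IsCompact closedTriangle := by
  rw [← convexHull_eq_closedTriangle]
  exact (Set.toFinite _).isCompact_convexHull ℝ

lemma tri_ae_eq_closedTriangle :
    tri (0, 0) (1, 0) (0, 1) =ᵐ[volume] closedTriangle := by
  rw [tri, ← convexHull_eq_closedTriangle]
  exact interior_ae_eq_of_null_frontier ((convex_convexHull ℝ _).addHaar_frontier _)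

lemma integrableOn_evalP_mul_bubble (u : MvPolynomial (Fin 2) ℝ) :
    IntegrableOn (fun p ↦ evalP u p * bubble (0, 0) (1, 0) (0, 1) p) closedTriangle := by
  refine ContinuousOn.integrableOn_compact isCompact_closedTriangle ?_
  refine ((continuous_evalP u).mul ?_).continuousOn
  simp only [funext bubble_unit_triangle]
  fun_prop

/-- Integration over the unit triangle against the weight `x y (1 - x - y)`. -/
def bubbleIntegral : MvPolynomial (Fin 2) ℝ →ₗ[ℝ] ℝ where
  toFun u := ∫ p in closedTriangle, evalP u p * bubble (0, 0) (1, 0) (0, 1) p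
  map_add' u v := by
    rw [← integral_add (integrableOn_evalP_mul_bubble u) (integrableOn_evalP_mul_bubble v)]
    simp only [evalP, map_add, add_mul]
  map_smul' c u := by
    rw [RingHom.id_apply, smul_eq_mul, ← integral_const_mul]
    simp only [evalP, smul_eval, mul_assoc]

lemma innerT_eq_bubbleIntegral (u v : MvPolynomial (Fin 2) ℝ) :
    innerT (0, 0) (1, 0) (0, 1) u v = bubbleIntegral (u * v) := by
  simp only [bubbleIntegral, LinearMap.coe_mk, AddHom.coe_mk, evalP_mul, innerT]
  exact setIntegral_congr_set tri_ae_eq_closedTriangle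

lemma integral_pow_mul_one_sub_pow (m k : ℕ) :
    ∫ x in (0 : ℝ)..1, x ^ m * (1 - x) ^ k =
      (m.factorial * k.factorial : ℝ) / (m + k + 1).factorial := by
  induction k generalizing m with
  | zero =>
    simp [integral_pow, Nat.factorial_succ]
    field_simp
  | succ k ih =>
    have hderiv (x : ℝ) : HasDerivAt (fun x : ℝ ↦ x ^ (m + 1) * (1 - x) ^ (k + 1))
        (((m : ℝ) + 1) * (x ^ m * (1 - x) ^ (k + 1)) -
          ((k : ℝ) + 1) * (x ^ (m + 1) * (1 - x) ^ k)) x := by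
      have h1 := (hasDerivAt_pow (m + 1) x).mul (((hasDerivAt_id x).const_sub 1).pow (k + 1))
      convert! h1 using 1
      simp
      ring
    have hcont (i j : ℕ) (c : ℝ) : IntervalIntegrable (fun x : ℝ ↦ c * (x ^ i * (1 - x) ^ j))
        volume 0 1 := Continuous.intervalIntegrable (by fun_prop) _ _
    have h := intervalIntegral.integral_eq_sub_of_hasDerivAt (fun x _ ↦ hderiv x)
      ((hcont m (k + 1) (m + 1)).sub (hcont (m + 1) k (k + 1)))
    rw [intervalIntegral.integral_sub (hcont _ _ _) (hcont _ _ _),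
      intervalIntegral.integral_const_mul, intervalIntegral.integral_const_mul, ih] at h
    have hm : (m : ℝ) + 1 ≠ 0 := by positivity
    refine mul_left_cancel₀ hm ?_
    rw [show m + (k + 1) + 1 = m + 1 + k + 1 by ring]
    simp at h
    rw [sub_eq_zero.mp h, Nat.factorial_succ m, Nat.factorial_succ k]
    push_cast
    ring

lemma integral_pow_mul_sub (b : ℕ) (t : ℝ) :
    ∫ y in (0 : ℝ)..t, y ^ (b + 1) * (t - y) = t ^ (b + 3) / ((b + 2) * (b + 3)) := by
  have h : ∀ y : ℝ, y ^ (b + 1) * (t - y) = t * y ^ (b + 1) - y ^ (b + 2) := fun y ↦ by ring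
  simp only [h]
  rw [intervalIntegral.integral_sub (Continuous.intervalIntegrable (by fun_prop) _ _)
    (Continuous.intervalIntegrable (by fun_prop) _ _), intervalIntegral.integral_const_mul,
    integral_pow, integral_pow]
  push_cast
  have : (b : ℝ) + 2 ≠ 0 := by positivity
  have : (b : ℝ) + 3 ≠ 0 := by positivity
  have : (b : ℝ) + 1 + 1 ≠ 0 := by positivity
  have : (b : ℝ) + 2 + 1 ≠ 0 := by positivity
  field_simp
  ring

lemma setIntegral_closedTriangle {F : ℝ × ℝ → ℝ} (hF : IntegrableOn F closedTriangle) :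
    ∫ p in closedTriangle, F p = ∫ x in (0 : ℝ)..1, ∫ y in (0 : ℝ)..(1 - x), F (x, y) := by
  have hm := isCompact_closedTriangle.measurableSet
  rw [← integrable_indicator_iff hm, Measure.volume_eq_prod] at hF
  rw [← integral_indicator hm, Measure.volume_eq_prod, integral_prod _ hF,
    intervalIntegral.integral_of_le zero_le_one, ← integral_Icc_eq_integral_Ioc,
    ← integral_indicator measurableSet_Icc]
  congr 1
  ext x
  by_cases hx : x ∈ Set.Icc (0 : ℝ) 1
  · rw [Set.indicator_of_mem hx, intervalIntegral.integral_of_le (by linarith [hx.2]),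
      ← integral_Icc_eq_integral_Ioc, ← integral_indicator measurableSet_Icc]
    congr 1
    ext y
    by_cases hy : y ∈ Set.Icc (0 : ℝ) (1 - x)
    · rw [Set.indicator_of_mem hy, Set.indicator_of_mem]
      exact ⟨hx.1, hy.1, by linarith [hy.2]⟩
    · rw [Set.indicator_of_notMem hy, Set.indicator_of_notMem]
      exact fun h ↦ hy ⟨h.2.1, by linarith [h.2.2]⟩
  · rw [Set.indicator_of_notMem hx]
    refine integral_eq_zero_of_ae (Filter.Eventually.of_forall fun y ↦ ?_)
    refine Set.indicator_of_notMem (fun h ↦ hx ⟨h.1, ?_⟩) _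
    have := h.2.1
    have := h.2.2
    simp only at *
    linarith

lemma hasTriangleMoments_bubbleIntegral : HasTriangleMoments bubbleIntegral := by
  intro s c
  have hF := integrableOn_evalP_mul_bubble (monomial s c)
  simp only [bubbleIntegral, LinearMap.coe_mk, AddHom.coe_mk]
  rw [setIntegral_closedTriangle hF]
  have h (x y : ℝ) : evalP (monomial s c) (x, y) * bubble (0, 0) (1, 0) (0, 1) (x, y) =
      c * x ^ (s 0 + 1) * (y ^ (s 1 + 1) * ((1 - x) - y)) := by
    rw [bubble_unit_triangle, evalP, eval_monomial, Finsupp.prod_fintype _ _ (by simp),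
      Fin.prod_univ_two]
    simp
    ring
  have h' (x : ℝ) : c * x ^ (s 0 + 1) * ((1 - x) ^ (s 1 + 3) / (((s 1 : ℝ) + 2) * (s 1 + 3))) =
      c / (((s 1 : ℝ) + 2) * (s 1 + 3)) * (x ^ (s 0 + 1) * (1 - x) ^ (s 1 + 3)) := by ring
  simp only [h, intervalIntegral.integral_const_mul, integral_pow_mul_sub, h',
    integral_pow_mul_one_sub_pow]
  rw [show s 0 + 1 + (s 1 + 3) + 1 = s 0 + s 1 + 5 by ring, Nat.factorial_succ (s 1 + 2),
    Nat.factorial_succ (s 1 + 1)]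
  push_cast
  have : (s 1 : ℝ) + 1 + 1 ≠ 0 := by positivity
  field_simp
  ring

lemma eq_zero_of_bubbleIntegral_mul_self {u : MvPolynomial (Fin 2) ℝ}
    (h : bubbleIntegral (u * u) = 0) : u = 0 := by
  have hF := integrableOn_evalP_mul_bubble (u * u)
  have hm := isCompact_closedTriangle.measurableSet
  simp only [bubbleIntegral, LinearMap.coe_mk, AddHom.coe_mk] at h
  rw [setIntegral_eq_zero_iff_of_nonneg_ae _ hF] at h
  · set U : Set (ℝ × ℝ) := Set.Ioo 0 (1 / 2) ×ˢ Set.Ioo 0 (1 / 2) with hU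
    have hsub : U ⊆ closedTriangle := fun p hp ↦
      ⟨hp.1.1.le, hp.2.1.le, by linarith [hp.1.2, hp.2.2]⟩
    have hcont : Continuous fun p ↦ evalP (u * u) p * bubble (0, 0) (1, 0) (0, 1) p := by
      refine (continuous_evalP _).mul ?_
      simp only [funext bubble_unit_triangle]
      fun_prop
    have hzero := Measure.eqOn_open_of_ae_eq (ae_restrict_of_ae_restrict_of_subset hsub h)
      (isOpen_Ioo.prod isOpen_Ioo) hcont.continuousOn continuousOn_const
    refine MvPolynomial.funext_set (fun _ ↦ Set.Ioo (0 : ℝ) (1 / 2))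
      (fun _ ↦ Set.Ioo_infinite (by norm_num)) fun x hx ↦ ?_
    have h0 := hx 0 (Set.mem_univ _)
    have h1 := hx 1 (Set.mem_univ _)
    have hz := hzero (x := (x 0, x 1)) ⟨h0, h1⟩
    simp only [evalP_mul, bubble_unit_triangle, Pi.zero_apply] at hz
    have hx' : ![x 0, x 1] = x := by ext i; fin_cases i <;> rfl
    have hw : (1 - x 0 - x 1) * x 0 * x 1 ≠ 0 := by
      have : 0 < 1 - x 0 - x 1 := by linarith [h0.2, h1.2]
      have := h0.1
      have := h1.1
      positivity
    have := mul_self_eq_zero.mp ((mul_eq_zero.mp hz).resolve_right hw)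
    rwa [evalP, hx'] at this
  · refine (ae_restrict_mem hm).mono fun p hp ↦ ?_
    have h1 := hp.1
    have h2 := hp.2.1
    have h3 : 0 ≤ 1 - p.1 - p.2 := by linarith [hp.2.2]
    simp only [Pi.zero_apply, evalP_mul, bubble_unit_triangle]
    have := mul_self_nonneg (evalP u p)
    positivity

/-- The involution `(x, y) ↦ (x + y, -y)` of the plane. -/
def reflectPoint : (ℝ × ℝ) ≃ₗ[ℝ] ℝ × ℝ :=
  LinearEquiv.ofInvolutive
    ((LinearMap.fst ℝ ℝ ℝ + LinearMap.snd ℝ ℝ ℝ).prod (-LinearMap.snd ℝ ℝ ℝ))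
    (fun p ↦ by ext <;> simp)

lemma reflectPoint_apply (p : ℝ × ℝ) : reflectPoint p = (p.1 + p.2, -p.2) := rfl

lemma evalP_reflectPoint (u : MvPolynomial (Fin 2) ℝ) (p : ℝ × ℝ) :
    evalP u (reflectPoint p) = evalP (reflect u) p := by
  induction u using MvPolynomial.induction_on with
  | C a => simp [evalP]
  | add f g hf hg => simp only [evalP, map_add] at *; rw [hf, hg]
  | mul_X f i hf =>
    rw [map_mul, evalP_mul, evalP_mul, hf]
    fin_cases i <;> simp [evalP, reflectPoint_apply]

lemma measurePreserving_reflectPoint : MeasurePreserving reflectPoint := by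
  have hinv : (reflectPoint : (ℝ × ℝ) →ₗ[ℝ] ℝ × ℝ) ∘ₗ reflectPoint = LinearMap.id :=
    LinearMap.ext fun p ↦ by simp [reflectPoint_apply]
  have hdet : LinearMap.det (reflectPoint : (ℝ × ℝ) →ₗ[ℝ] ℝ × ℝ) *
      LinearMap.det (reflectPoint : (ℝ × ℝ) →ₗ[ℝ] ℝ × ℝ) = 1 := by
    rw [← LinearMap.det_comp, hinv, LinearMap.det_id]
  have habs : |(LinearMap.det (reflectPoint : (ℝ × ℝ) →ₗ[ℝ] ℝ × ℝ))⁻¹| = 1 := by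
    rcases mul_self_eq_one_iff.mp hdet with h | h <;> simp [h]
  refine ⟨reflectPoint.toContinuousLinearEquiv.continuous.measurable, ?_⟩
  have := Measure.map_linearMap_addHaar_eq_smul_addHaar (volume : Measure (ℝ × ℝ))
    (f := reflectPoint) (left_ne_zero_of_mul_eq_one hdet)
  rw [habs, ENNReal.ofReal_one, one_smul] at this
  exact this

lemma image_reflectPoint_tri :
    reflectPoint '' tri (0, 0) (1, 0) (0, 1) = tri (1, 0) (0, 0) (1, -1) := by
  have h := reflectPoint.toContinuousLinearEquiv.toHomeomorph.image_interior
    (convexHull ℝ {((0 : ℝ), (0 : ℝ)), (1, 0), (0, 1)})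
  have h2 := (reflectPoint : (ℝ × ℝ) →ₗ[ℝ] ℝ × ℝ).image_convexHull
    {((0 : ℝ), (0 : ℝ)), (1, 0), (0, 1)}
  rw [tri, tri, Set.insert_comm (1, 0)]
  refine h.trans (congrArg interior (h2.trans ?_))
  simp [Set.image_insert_eq, reflectPoint_apply]

lemma innerT_reflect (u v : MvPolynomial (Fin 2) ℝ) :
    innerT (1, 0) (0, 0) (1, -1) u v =
      innerT (0, 0) (1, 0) (0, 1) (reflect u) (reflect v) := by
  rw [innerT, ← image_reflectPoint_tri, measurePreserving_reflectPoint.setIntegral_image_emb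
    reflectPoint.toContinuousLinearEquiv.toHomeomorph.measurableEmbedding, innerT]
  refine integral_congr_ae (Filter.Eventually.of_forall fun p ↦ ?_)
  simp only [evalP_reflectPoint]
  congr 1
  simp only [bubble, bary, det2, reflectPoint_apply, Prod.fst_sub, Prod.snd_sub]
  ring

lemma inPerp_reflect {n : ℕ} {u : MvPolynomial (Fin 2) ℝ} :
    inPerp n (1, 0) (0, 0) (1, -1) u ↔ inPerp n (0, 0) (1, 0) (0, 1) (reflect u) := by
  constructor
  · rintro ⟨hd, h⟩
    refine ⟨(totalDegree_reflect_le u).trans hd, fun w hw ↦ ?_⟩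
    rw [← reflect_reflect w, ← innerT_reflect]
    exact h _ ((totalDegree_reflect_le w).trans hw)
  · rintro ⟨hd, h⟩
    refine ⟨?_, fun w hw ↦ ?_⟩
    · rw [← reflect_reflect u]
      exact (totalDegree_reflect_le _).trans hd
    · rw [innerT_reflect]
      exact h _ ((totalDegree_reflect_le w).trans hw)

lemma triangleOp_eq_of_inPerp {n : ℕ} {u : MvPolynomial (Fin 2) ℝ}
    (hu : inPerp n (0, 0) (1, 0) (0, 1) u) :
    triangleOp u = C (-((n : ℝ) * (n + 5))) * u :=
  hasTriangleMoments_bubbleIntegral.triangleOp_eq_of_orthogonal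
    (fun _ ↦ eq_zero_of_bubbleIntegral_mul_self) hu.1
    fun v hv ↦ (innerT_eq_bubbleIntegral u v).symm.trans (hu.2 v hv)

lemma inPerp_smul {n : ℕ} {u : MvPolynomial (Fin 2) ℝ} (t : ℝ)
    (hu : inPerp n (0, 0) (1, 0) (0, 1) u) : inPerp n (0, 0) (1, 0) (0, 1) (t • u) := by
  refine ⟨(totalDegree_smul_le t u).trans hu.1, fun w hw ↦ ?_⟩
  have := hu.2 w hw
  rw [innerT_eq_bubbleIntegral] at this ⊢
  rw [smul_mul_assoc, map_smul, this, smul_zero]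

lemma inPerp_sub {n : ℕ} {u v : MvPolynomial (Fin 2) ℝ}
    (hu : inPerp n (0, 0) (1, 0) (0, 1) u) (hv : inPerp n (0, 0) (1, 0) (0, 1) v) :
    inPerp n (0, 0) (1, 0) (0, 1) (u - v) := by
  refine ⟨(totalDegree_sub u v).trans (max_le hu.1 hv.1), fun w hw ↦ ?_⟩
  have h1 := hu.2 w hw
  have h2 := hv.2 w hw
  rw [innerT_eq_bubbleIntegral] at h1 h2 ⊢
  rw [sub_mul, map_sub, h1, h2, sub_zero]

lemma inPerp_dividedDifference {n : ℕ} (hn : 1 ≤ n) {f : Polynomial ℝ}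
    (hdeg : f.natDegree ≤ n + 1)
    (hf : Polynomial.X * (1 - Polynomial.X) * Polynomial.derivative (Polynomial.derivative f) +
      (2 - 4 * Polynomial.X) * Polynomial.derivative f +
      Polynomial.C (((n : ℝ) + 1) * (n + 4)) * f = 0) :
    inPerp n (0, 0) (1, 0) (0, 1) (dividedDifference f) := by
  refine ⟨totalDegree_dividedDifference_le hdeg, fun w hw ↦ ?_⟩
  rw [innerT_eq_bubbleIntegral]
  exact hasTriangleMoments_bubbleIntegral.orthogonal_of_triangleOp_eq
    (triangleOp_dividedDifference hf) (n - 1) (by omega) w hw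

/-- A polynomial in both orthogonal complements is determined by its coefficient of `x ^ n`. -/
lemma eq_zero_of_inPerp_of_coeff_eq_zero {n : ℕ} {u : MvPolynomial (Fin 2) ℝ}
    (hu : inPerp n (0, 0) (1, 0) (0, 1) u) (hr : inPerp n (0, 0) (1, 0) (0, 1) (reflect u))
    (h0 : coeff (Finsupp.single 0 n) u = 0) : u = 0 := by
  have hd := totalDegree_le_of_pderiv_pderiv_X_mul_eq hu.1
    (pderiv_pderiv_X_mul_eq (triangleOp_eq_of_inPerp hu) (triangleOp_eq_of_inPerp hr)) h0
  exact eq_zero_of_bubbleIntegral_mul_self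
    ((innerT_eq_bubbleIntegral u u).symm.trans (hu.2 u hd))

lemma evalP_dividedDifference_shiftedJacobi (N : ℕ) (p : ℝ × ℝ) :
    evalP (dividedDifference (shiftedJacobi N)) p * p.2 =
      jacobiR N 1 1 (1 - 2 * (p.1 + p.2)) - jacobiR N 1 1 (1 - 2 * p.1) := by
  have h := congrArg (eval ![p.1, p.2]) (X_mul_dividedDifference (shiftedJacobi N))
  have haeval (g : MvPolynomial (Fin 2) ℝ) : eval ![p.1, p.2]
      (Polynomial.aeval g (shiftedJacobi N)) = (shiftedJacobi N).eval (eval ![p.1, p.2] g) := by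
    rw [Polynomial.aeval_def, Polynomial.hom_eval₂, Polynomial.eval, algebraMap_eq]
    congr 1
    ext a
    simp
  rw [map_sub, haeval, haeval, map_mul, eval_X, mul_comm] at h
  simpa [shiftedJacobi, jacobiR, evalP, Polynomial.eval_comp] using h

/-- For `n ≥ 1`, `P_{n-1}^⊥(T₁) ∩ P_{n-1}^⊥(K_{1,0})` is one-dimensional,
spanned by the polynomial `q_n^{(1,0)}(x,y) = y⁻¹ (P_{n+1}^{(1,1)}(1-2(x+y)) -
P_{n+1}^{(1,1)}(1-2x))`, a bivariate polynomial of total degree `n`.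
Here `K_{1,0} = conv°((1,0),(0,0),(1,-1))`. -/
theorem statement5 (n : ℕ) (hn : 1 ≤ n) :
    ∃ qn : MvPolynomial (Fin 2) ℝ,
      (∀ p : ℝ × ℝ, evalP qn p * p.2 =
        jacobiR (n + 1) 1 1 (1 - 2 * (p.1 + p.2)) - jacobiR (n + 1) 1 1 (1 - 2 * p.1)) ∧
      qn.totalDegree = n ∧
      ∀ u : MvPolynomial (Fin 2) ℝ,
        (inPerp n (0, 0) (1, 0) (0, 1) u ∧ inPerp n (1, 0) (0, 0) (1, -1) u) ↔
          ∃ t : ℝ, u = t • qn := by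
  have hdeg := natDegree_shiftedJacobi_le (n + 1)
  have hperp := inPerp_dividedDifference hn hdeg (shiftedJacobi_ode n)
  have hcoeff : coeff (Finsupp.single 0 n) (dividedDifference (shiftedJacobi (n + 1))) ≠ 0 := by
    rw [coeff_dividedDifference]
    exact mul_ne_zero (shiftedJacobi_coeff_ne_zero (n + 1)) (by positivity)
  have hrefl := reflect_dividedDifference (shiftedJacobi (n + 1))
  set q := dividedDifference (shiftedJacobi (n + 1))
  refine ⟨q, evalP_dividedDifference_shiftedJacobi (n + 1), le_antisymm hperp.1 ?_, fun u ↦ ?_⟩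
  · have := le_totalDegree (mem_support_iff.mpr hcoeff)
    rwa [Finsupp.sum_single_index rfl] at this
  · rw [inPerp_reflect]
    constructor
    · rintro ⟨hu, hr⟩
      refine ⟨coeff (Finsupp.single 0 n) u / coeff (Finsupp.single 0 n) q, sub_eq_zero.mp ?_⟩
      refine eq_zero_of_inPerp_of_coeff_eq_zero (inPerp_sub hu (inPerp_smul _ hperp)) ?_ ?_
      · rw [map_sub, map_smul, hrefl]
        exact inPerp_sub hr (inPerp_smul _ hperp)
      · rw [coeff_sub, coeff_smul, smul_eq_mul, div_mul_cancel₀ _ hcoeff, sub_self]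
    · rintro ⟨t, rfl⟩
      refine ⟨inPerp_smul t hperp, ?_⟩
      rw [map_smul, hrefl]
      exact inPerp_smul t hperp
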